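/- arXiv:1708.01243 — 5 statements merged into one kernel-verified Lean document; each statement's English description precedes it below -/
import Mathlib

section
/- Let W (N_q × N_q) and W_f (N_f × N_f) be real diagonal matrices, V_q an N_q × N_p real matrix with M = V_qᵀ W V_q invertible, P_q = M⁻¹ V_qᵀ W, V_f an N_f × N_p real matrix, and let n̂ be a vector in ℝ^{N_f}. Suppose the modal differentiation matrix D (N_p × N_p) satisfies the modal summation-by-parts property M D + Dᵀ M = V_fᵀ W_f diag(n̂) V_f. Then the quadrature-based differentiation matrix D_q = V_q D P_q satisfies the SBP property with respect to the diagonal norm W: W D_q + (W D_q)ᵀ = P_qᵀ V_fᵀ W_f diag(n̂) V_f P_q. -/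
open Matrix

/-- If the modal differentiation matrix `D` satisfies the modal
summation-by-parts property `M * D + Dᵀ * M = Vfᵀ * Wf * diagonal nhat * Vf` with
`M = Vqᵀ * W * Vq` invertible, then the quadrature-based differentiation matrix
`Dq = Vq * D * Pq` (with `Pq = M⁻¹ * Vqᵀ * W`) satisfies the SBP property
`W * Dq + (W * Dq)ᵀ = Pqᵀ * Vfᵀ * Wf * diagonal nhat * Vf * Pq`. -/
theorem quadrature_diff_matrix_sbp
    (Np Nq Nf : ℕ)
    (W : Matrix (Fin Nq) (Fin Nq) ℝ) (hWdiag : W.IsDiag)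
    (Wf : Matrix (Fin Nf) (Fin Nf) ℝ) (hWfdiag : Wf.IsDiag)
    (Vq : Matrix (Fin Nq) (Fin Np) ℝ)
    (Vf : Matrix (Fin Nf) (Fin Np) ℝ)
    (nhat : Fin Nf → ℝ)
    (D : Matrix (Fin Np) (Fin Np) ℝ)
    (hM : IsUnit (Vqᵀ * W * Vq).det)
    (hSBP : (Vqᵀ * W * Vq) * D + Dᵀ * (Vqᵀ * W * Vq) = Vfᵀ * Wf * diagonal nhat * Vf) :
    W * (Vq * D * ((Vqᵀ * W * Vq)⁻¹ * Vqᵀ * W)) +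
        (W * (Vq * D * ((Vqᵀ * W * Vq)⁻¹ * Vqᵀ * W)))ᵀ =
      ((Vqᵀ * W * Vq)⁻¹ * Vqᵀ * W)ᵀ * Vfᵀ * Wf * diagonal nhat * Vf *
        ((Vqᵀ * W * Vq)⁻¹ * Vqᵀ * W) := by
  have hW : Wᵀ = W := hWdiag.isSymm
  have hMt : (Vqᵀ * W * Vq)ᵀ = Vqᵀ * W * Vq := by
    simp [transpose_mul, hW, Matrix.mul_assoc]
  have hP : (Vqᵀ * W * Vq) * ((Vqᵀ * W * Vq)⁻¹ * Vqᵀ * W) = Vqᵀ * W := by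
    rw [Matrix.mul_assoc _ Vqᵀ W, mul_nonsing_inv_cancel_left _ _ hM]
  generalize Vqᵀ * W * Vq = M at *
  generalize M⁻¹ * Vqᵀ * W = P at *
  have hPt : W * Vq = Pᵀ * M := by
    have h := congrArg transpose hP
    rw [transpose_mul, transpose_mul, transpose_transpose, hMt, hW] at h
    exact h.symm
  have hD : W * (Vq * D * P) = Pᵀ * (M * D) * P := by
    rw [Matrix.mul_assoc Vq, ← Matrix.mul_assoc W, hPt]
    simp only [Matrix.mul_assoc]
  have hR : Pᵀ * Vfᵀ * Wf * diagonal nhat * Vf * P =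
      Pᵀ * (Vfᵀ * Wf * diagonal nhat * Vf) * P := by
    simp only [Matrix.mul_assoc]
  rw [hR, ← hSBP, hD, Matrix.mul_add, Matrix.add_mul]
  simp only [transpose_mul, transpose_transpose, hMt, Matrix.mul_assoc]
end

section
/- Let W (N_q × N_q) and W_f (N_f × N_f) be real diagonal matrices, V_q an N_q × N_p matrix with M = V_qᵀ W V_q invertible, P_q = M⁻¹ V_qᵀ W, L_q = M⁻¹ V_fᵀ W_f, V_f an N_f × N_p matrix, n̂ ∈ ℝ^{N_f}, and D an N_p × N_p matrix satisfying M D + Dᵀ M = V_fᵀ W_f diag(n̂) V_f. Define D_q = V_q D P_q, the (N_q + N_f) × (N_q + N_f) block matrix D_N with blocks [D_q − ½ V_q L_q diag(n̂) V_f P_q , ½ V_q L_q diag(n̂); −½ diag(n̂) V_f P_q , ½ diag(n̂)], the block diagonal weight matrix W_N = blockdiag(W, W_f), and Q_N = W_N D_N. Then Q_N + Q_Nᵀ = B_N, where B_N is the block diagonal matrix blockdiag(0, W_f diag(n̂)). -/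
open Matrix

/-- The quadrature-based L² projection matrix `Pq = M⁻¹ * Vqᵀ * W`,
with mass matrix `M = Vqᵀ * W * Vq`. -/
noncomputable def projMat {Np Nq : ℕ}
    (W : Matrix (Fin Nq) (Fin Nq) ℝ) (Vq : Matrix (Fin Nq) (Fin Np) ℝ) :
    Matrix (Fin Np) (Fin Nq) ℝ :=
  (Vqᵀ * W * Vq)⁻¹ * Vqᵀ * W

/-- The quadrature-based lifting matrix `Lq = M⁻¹ * Vfᵀ * Wf`. -/
noncomputable def liftMat {Np Nq Nf : ℕ}
    (W : Matrix (Fin Nq) (Fin Nq) ℝ) (Vq : Matrix (Fin Nq) (Fin Np) ℝ)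
    (Wf : Matrix (Fin Nf) (Fin Nf) ℝ) (Vf : Matrix (Fin Nf) (Fin Np) ℝ) :
    Matrix (Fin Np) (Fin Nf) ℝ :=
  (Vqᵀ * W * Vq)⁻¹ * Vfᵀ * Wf

/-- The quadrature-based differentiation matrix `Dq = Vq * D * Pq`. -/
noncomputable def quadDiffMat {Np Nq : ℕ}
    (W : Matrix (Fin Nq) (Fin Nq) ℝ) (Vq : Matrix (Fin Nq) (Fin Np) ℝ)
    (D : Matrix (Fin Np) (Fin Np) ℝ) :
    Matrix (Fin Nq) (Fin Nq) ℝ :=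
  Vq * D * projMat W Vq

/-- The "decoupled" SBP-like block operator `D_N` with blocks
`[Dq − ½ Vq Lq diag(n̂) Vf Pq , ½ Vq Lq diag(n̂); −½ diag(n̂) Vf Pq , ½ diag(n̂)]`. -/
noncomputable def decoupledDN {Np Nq Nf : ℕ}
    (W : Matrix (Fin Nq) (Fin Nq) ℝ) (Vq : Matrix (Fin Nq) (Fin Np) ℝ)
    (Wf : Matrix (Fin Nf) (Fin Nf) ℝ) (Vf : Matrix (Fin Nf) (Fin Np) ℝ)
    (nhat : Fin Nf → ℝ) (D : Matrix (Fin Np) (Fin Np) ℝ) :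
    Matrix (Fin Nq ⊕ Fin Nf) (Fin Nq ⊕ Fin Nf) ℝ :=
  fromBlocks
    (quadDiffMat W Vq D -
      (1 / 2 : ℝ) • (Vq * liftMat W Vq Wf Vf * diagonal nhat * Vf * projMat W Vq))
    ((1 / 2 : ℝ) • (Vq * liftMat W Vq Wf Vf * diagonal nhat))
    (-(1 / 2 : ℝ) • (diagonal nhat * Vf * projMat W Vq))
    ((1 / 2 : ℝ) • diagonal nhat)

/-- The block diagonal weight matrix `W_N = blockdiag(W, W_f)`. -/
def weightWN {Nq Nf : ℕ}
    (W : Matrix (Fin Nq) (Fin Nq) ℝ) (Wf : Matrix (Fin Nf) (Fin Nf) ℝ) :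
    Matrix (Fin Nq ⊕ Fin Nf) (Fin Nq ⊕ Fin Nf) ℝ :=
  fromBlocks W 0 0 Wf

section Decoupled

variable {Np Nq Nf : ℕ} {W : Matrix (Fin Nq) (Fin Nq) ℝ} {Vq : Matrix (Fin Nq) (Fin Np) ℝ}

/-- For a symmetric weight matrix, the mass matrix is symmetric. -/
theorem transpose_massMatrix (hW : Wᵀ = W) : (Vqᵀ * W * Vq)ᵀ = Vqᵀ * W * Vq := by
  simp only [transpose_mul, transpose_transpose, hW, Matrix.mul_assoc]

/-- For a symmetric weight matrix, `W * Vq = Pqᵀ * M`. -/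
theorem weight_mul_interp_eq (hW : Wᵀ = W) (hM : IsUnit (Vqᵀ * W * Vq).det) :
    W * Vq = (projMat W Vq)ᵀ * (Vqᵀ * W * Vq) := by
  rw [projMat, transpose_mul, transpose_mul, transpose_transpose, transpose_nonsing_inv,
    transpose_massMatrix hW, hW, ← Matrix.mul_assoc W, Matrix.nonsing_inv_mul_cancel_right _ _ hM]

/-- For a symmetric weight matrix, `W * Vq * Lq = Pqᵀ * Vfᵀ * Wf`. -/
theorem weight_mul_interp_mul_liftMat (hW : Wᵀ = W)
    (Wf : Matrix (Fin Nf) (Fin Nf) ℝ) (Vf : Matrix (Fin Nf) (Fin Np) ℝ) :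
    W * Vq * liftMat W Vq Wf Vf = (projMat W Vq)ᵀ * Vfᵀ * Wf := by
  rw [projMat, liftMat, transpose_mul, transpose_mul, transpose_transpose, transpose_nonsing_inv,
    transpose_massMatrix hW, hW]
  simp only [Matrix.mul_assoc]

end Decoupled

/-- The weak decoupled operator `Q_N = W_N * D_N` satisfies the SBP-like
property `Q_N + Q_Nᵀ = B_N` with `B_N = blockdiag(0, Wf * diagonal nhat)`. -/
theorem decoupled_sbp_property
    (Np Nq Nf : ℕ)
    (W : Matrix (Fin Nq) (Fin Nq) ℝ) (hWdiag : W.IsDiag)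
    (Wf : Matrix (Fin Nf) (Fin Nf) ℝ) (hWfdiag : Wf.IsDiag)
    (Vq : Matrix (Fin Nq) (Fin Np) ℝ)
    (Vf : Matrix (Fin Nf) (Fin Np) ℝ)
    (nhat : Fin Nf → ℝ)
    (D : Matrix (Fin Np) (Fin Np) ℝ)
    (hM : IsUnit (Vqᵀ * W * Vq).det)
    (hSBP : (Vqᵀ * W * Vq) * D + Dᵀ * (Vqᵀ * W * Vq) = Vfᵀ * Wf * diagonal nhat * Vf) :
    weightWN W Wf * decoupledDN W Vq Wf Vf nhat D +
        (weightWN W Wf * decoupledDN W Vq Wf Vf nhat D)ᵀ =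
      fromBlocks 0 0 0 (Wf * diagonal nhat) := by
  have hW : Wᵀ = W := hWdiag.isSymm
  have hWf : Wfᵀ = Wf := hWfdiag.isSymm
  have hcomm : diagonal nhat * Wf = Wf * diagonal nhat := by
    rw [← hWfdiag.diagonal_diag, diagonal_mul_diagonal, diagonal_mul_diagonal]
    simp only [mul_comm]
  have hlift := weight_mul_interp_mul_liftMat (Vq := Vq) hW Wf Vf
  have hinterp := weight_mul_interp_eq hW hM
  have hMt := transpose_massMatrix (Vq := Vq) hW
  rw [weightWN, decoupledDN, quadDiffMat, fromBlocks_multiply, fromBlocks_transpose,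
    fromBlocks_add]
  simp only [Matrix.zero_mul, smul_zero, sub_zero, add_zero, zero_add, Matrix.mul_sub,
    Matrix.mul_smul, ← Matrix.mul_assoc, hlift]
  generalize projMat W Vq = P at *
  rw [hinterp]
  generalize Vqᵀ * W * Vq = M at *
  have hcross : (Wf * diagonal nhat * Vf * P)ᵀ = Pᵀ * Vfᵀ * Wf * diagonal nhat := by
    simp only [transpose_mul, diagonal_transpose, hWf, hcomm, Matrix.mul_assoc]
  have hcross' : (Pᵀ * Vfᵀ * Wf * diagonal nhat)ᵀ = Wf * diagonal nhat * Vf * P := by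
    rw [← hcross, transpose_transpose]
  have hvol : Pᵀ * M * D * P + (Pᵀ * M * D * P)ᵀ = Pᵀ * Vfᵀ * Wf * diagonal nhat * Vf * P := by
    have h := congrArg (fun X => Pᵀ * X * P) hSBP
    simpa only [Matrix.mul_add, Matrix.add_mul, transpose_mul, transpose_transpose, hMt,
      Matrix.mul_assoc] using h
  have hsurf : (Pᵀ * Vfᵀ * Wf * diagonal nhat * Vf * P)ᵀ =
      Pᵀ * Vfᵀ * Wf * diagonal nhat * Vf * P := by
    rw [← hvol, transpose_add, transpose_transpose, add_comm]
  have hbdry : (Wf * diagonal nhat)ᵀ = Wf * diagonal nhat := by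
    rw [transpose_mul, diagonal_transpose, hWf, hcomm]
  congr 1
  · rw [transpose_sub, transpose_smul, hsurf, sub_add_sub_comm, hvol]
    module
  · rw [transpose_smul, hcross]
    module
  · rw [transpose_smul, hcross']
    module
  · rw [transpose_smul, hbdry]
    module
end

section
/- Let W, W_f, V_q, V_f, M = V_qᵀ W V_q (invertible), P_q = M⁻¹ V_qᵀ W, L_q = M⁻¹ V_fᵀ W_f, n̂, D, D_q = V_q D P_q, and the block operator D_N with blocks [D_q − ½ V_q L_q diag(n̂) V_f P_q , ½ V_q L_q diag(n̂); −½ diag(n̂) V_f P_q , ½ diag(n̂)] be as in the decoupled SBP construction. Suppose in addition there is a coefficient vector c ∈ ℝ^{N_p} representing the constant function, i.e. V_q c = 1 (the all-ones vector in ℝ^{N_q}), V_f c = 1 (the all-ones vector in ℝ^{N_f}), and D c = 0. Then D_N 1 = 0, where 1 is the all-ones vector in ℝ^{N_q + N_f}; consequently Q_N 1 = 0 for Q_N = W_N D_N with W_N = blockdiag(W, W_f). -/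
open Matrix

/-- The projection matrix is a left inverse of the interpolation matrix `Vq`. -/
theorem projMat_mul_self {Np Nq : ℕ}
    (W : Matrix (Fin Nq) (Fin Nq) ℝ) (Vq : Matrix (Fin Nq) (Fin Np) ℝ)
    (hM : IsUnit (Vqᵀ * W * Vq).det) :
    projMat W Vq * Vq = 1 := by
  simpa only [projMat, Matrix.mul_assoc] using nonsing_inv_mul _ hM

/-- If the approximation space contains the constant function
(there is `c` with `Vq *ᵥ c = 1`, `Vf *ᵥ c = 1`, `D *ᵥ c = 0`), then the decoupled
operator annihilates the all-ones vector: `D_N *ᵥ 1 = 0`, and consequently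
`Q_N *ᵥ 1 = 0` for `Q_N = W_N * D_N`. -/
theorem decoupled_annihilates_constants
    (Np Nq Nf : ℕ)
    (W : Matrix (Fin Nq) (Fin Nq) ℝ) (hWdiag : W.IsDiag)
    (Wf : Matrix (Fin Nf) (Fin Nf) ℝ) (hWfdiag : Wf.IsDiag)
    (Vq : Matrix (Fin Nq) (Fin Np) ℝ)
    (Vf : Matrix (Fin Nf) (Fin Np) ℝ)
    (nhat : Fin Nf → ℝ)
    (D : Matrix (Fin Np) (Fin Np) ℝ)
    (hM : IsUnit (Vqᵀ * W * Vq).det)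
    (c : Fin Np → ℝ)
    (hcq : Vq *ᵥ c = 1)
    (hcf : Vf *ᵥ c = 1)
    (hDc : D *ᵥ c = 0) :
    decoupledDN W Vq Wf Vf nhat D *ᵥ (1 : Fin Nq ⊕ Fin Nf → ℝ) = 0 ∧
      (weightWN W Wf * decoupledDN W Vq Wf Vf nhat D) *ᵥ (1 : Fin Nq ⊕ Fin Nf → ℝ) = 0 := by
  have hP : projMat W Vq *ᵥ 1 = c := by
    rw [← hcq, mulVec_mulVec, projMat_mul_self W Vq hM, one_mulVec]
  have hD : decoupledDN W Vq Wf Vf nhat D *ᵥ (1 : Fin Nq ⊕ Fin Nf → ℝ) = 0 := by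
    rw [← Sum.elim_one_one, decoupledDN, fromBlocks_mulVec, ← Sum.elim_zero_zero]
    congr 1 <;>
      simp [quadDiffMat, sub_mulVec, neg_mulVec, smul_mulVec, ← mulVec_mulVec, hP, hcf, hDc]
  exact ⟨hD, by rw [← mulVec_mulVec, hD, mulVec_zero]⟩
end

section
/- Let W, W_f, V_q, V_f, M = V_qᵀ W V_q (invertible), P_q = M⁻¹ V_qᵀ W, L_q = M⁻¹ V_fᵀ W_f, n̂, D, D_q = V_q D P_q be as in the decoupled SBP construction, and let D_N be the block matrix with blocks [D_q − ½ V_q L_q diag(n̂) V_f P_q , ½ V_q L_q diag(n̂); −½ diag(n̂) V_f P_q , ½ diag(n̂)]. Then for any coefficient vector u ∈ ℝ^{N_p}, applying D_N to the concatenated vector (V_q u, V_f u) yields (V_q D u, 0); i.e., the volume rows of D_N recover the exact derivative of a polynomial while the surface rows return zero. -/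
open Matrix

/-- Applying the decoupled operator `D_N` to the concatenated evaluations
`(Vq *ᵥ u, Vf *ᵥ u)` of a polynomial with coefficients `u` yields the exact derivative
evaluations on the volume rows and zero on the surface rows: `(Vq *ᵥ (D *ᵥ u), 0)`. -/
theorem decoupled_on_polynomial_evaluations
    (Np Nq Nf : ℕ)
    (W : Matrix (Fin Nq) (Fin Nq) ℝ) (hWdiag : W.IsDiag)
    (Wf : Matrix (Fin Nf) (Fin Nf) ℝ) (hWfdiag : Wf.IsDiag)
    (Vq : Matrix (Fin Nq) (Fin Np) ℝ)
    (Vf : Matrix (Fin Nf) (Fin Np) ℝ)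
    (nhat : Fin Nf → ℝ)
    (D : Matrix (Fin Np) (Fin Np) ℝ)
    (hM : IsUnit (Vqᵀ * W * Vq).det)
    (u : Fin Np → ℝ) :
    decoupledDN W Vq Wf Vf nhat D *ᵥ Sum.elim (Vq *ᵥ u) (Vf *ᵥ u) =
      Sum.elim (Vq *ᵥ (D *ᵥ u)) 0 := by
  have hP := projMat_mul_self W Vq hM
  rw [decoupledDN, fromBlocks_mulVec, Sum.elim_comp_inl, Sum.elim_comp_inr]
  congr 1
  · simp only [quadDiffMat, mulVec_mulVec, Matrix.sub_mul, Matrix.smul_mul, Matrix.mul_assoc, hP,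
      Matrix.mul_one, ← add_mulVec, sub_add_cancel]
  · simp only [mulVec_mulVec, ← add_mulVec, Matrix.smul_mul, Matrix.mul_assoc, hP, Matrix.mul_one,
      neg_smul, Matrix.neg_mul, neg_add_cancel, zero_mulVec]
end

section
/- Let f_S : ℝⁿ × ℝⁿ → ℝⁿ be symmetric (f_S(a,b) = f_S(b,a)) and consistent with f : ℝⁿ → ℝⁿ (f_S(a,a) = f(a)), let u : ℝ → ℝⁿ be differentiable at x ∈ ℝ, and suppose f_S is Fréchet differentiable at (u(x), u(x)). Then the composite x ↦ f(u(x)) is differentiable at x and its derivative equals twice the derivative of the frozen-argument map: d/dx [f(u(x))] = 2 · d/dz [f_S(u(z), u(x))] evaluated at z = x. -/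
/-- Flux differencing identity. If `fS` is symmetric and consistent with
`f`, `u : ℝ → ℝⁿ` is differentiable at `x`, and `fS` is Fréchet differentiable at
`(u x, u x)`, then `y ↦ f (u y)` is differentiable at `x` with derivative equal to
twice the derivative at `x` of the frozen-argument map `z ↦ fS (u z) (u x)`. -/
theorem flux_differencing_identity
    (n : ℕ)
    (f : (Fin n → ℝ) → (Fin n → ℝ))
    (fS : (Fin n → ℝ) → (Fin n → ℝ) → (Fin n → ℝ))
    (hsymm : ∀ a b, fS a b = fS b a)
    (hcons : ∀ a, fS a a = f a)
    (u : ℝ → (Fin n → ℝ)) (x : ℝ)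
    (hu : DifferentiableAt ℝ u x)
    (hfS : DifferentiableAt ℝ
      (fun p : (Fin n → ℝ) × (Fin n → ℝ) => fS p.1 p.2) (u x, u x)) :
    HasDerivAt (fun y => f (u y))
      ((2 : ℝ) • deriv (fun z => fS (u z) (u x)) x) x := by
  obtain ⟨L, hL⟩ := hfS
  have hu' := hu.hasDerivAt
  have hdiag : HasDerivAt (fun y => fS (u y) (u y)) (L (deriv u x, deriv u x)) x :=
    HasFDerivAt.comp_hasDerivAt (f := fun y => (u y, u y)) x hL (hu'.prodMk hu')
  have hfst : HasDerivAt (fun y => fS (u y) (u x)) (L (deriv u x, 0)) x :=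
    HasFDerivAt.comp_hasDerivAt (f := fun y => (u y, u x)) x hL
      (hu'.prodMk (hasDerivAt_const x (u x)))
  have hsnd : HasDerivAt (fun y => fS (u x) (u y)) (L (0, deriv u x)) x :=
    HasFDerivAt.comp_hasDerivAt (f := fun y => (u x, u y)) x hL
      ((hasDerivAt_const x (u x)).prodMk hu')
  simp only [hsymm (u x)] at hsnd
  have hsplit : L (deriv u x, deriv u x) = (2 : ℝ) • L (deriv u x, 0) := by
    rw [two_smul]
    nth_rewrite 2 [hfst.unique hsnd]
    rw [← map_add, Prod.mk_add_mk, add_zero, zero_add]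
  rw [hfst.deriv, ← hsplit]
  simpa only [hcons] using hdiag
end
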